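/- arXiv:1511.00473 — 2 statements merged into one kernel-verified Lean document; each statement's English description precedes it below -/
import Mathlib

section
/- Let C and D be finitely based permutation classes. Then each of the following three 2×2 grid classes is finitely based: (i) Grid(C,D; Av(21),Av(21)), (ii) Grid(C,D; Av(21),Av(12)), and (iii) Grid(C,D; Av(12),Av(21)), where in each case C is the top-left entry, D the top-right, and the bottom row consists of the indicated monotone classes. -/
/-- A permutation of length `n`, given as a bijection of `Fin n`
(index/value `i` represents the entry `i+1` of `{1,…,n}`). -/
abbrev Perm' := Σ n : ℕ, Equiv.Perm (Fin n)

/-- `Contains σ π` means the pattern `σ` is contained in `π`. -/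
def Contains (σ π : Perm') : Prop :=
  ∃ f : Fin σ.1 → Fin π.1, StrictMono f ∧
    ∀ i j : Fin σ.1, σ.2 i < σ.2 j ↔ π.2 (f i) < π.2 (f j)

/-- A permutation class: a downward-closed set of permutations. -/
def IsPermClass (X : Set Perm') : Prop :=
  ∀ π ∈ X, ∀ σ : Perm', Contains σ π → σ ∈ X

/-- The avoidance set of a set `B` of permutations. -/
def Av (B : Set Perm') : Set Perm' := {π | ∀ β ∈ B, ¬ Contains β π}

/-- A set of permutations is finitely based if it is `Av B` for a finite `B`. -/
def FinitelyBased (X : Set Perm') : Prop := ∃ B : Set Perm', B.Finite ∧ X = Av B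

/-- `PatternOn π S σ`: the entries of `π` at the set `S` of indices form a copy of `σ`. -/
def PatternOn (π : Perm') (S : Set (Fin π.1)) (σ : Perm') : Prop :=
  ∃ f : Fin σ.1 → Fin π.1, StrictMono f ∧ Set.range f = S ∧
    ∀ i j : Fin σ.1, σ.2 i < σ.2 j ↔ π.2 (f i) < π.2 (f j)

/-- `PatternIn π S X`: the pattern of the entries of `π` at positions `S` lies in `X`. -/
def PatternIn (π : Perm') (S : Set (Fin π.1)) (X : Set Perm') : Prop :=
  ∃ σ ∈ X, PatternOn π S σ

/-- The permutation 21. -/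
def perm21 : Perm' := ⟨2, Equiv.swap 0 1⟩
/-- The permutation 12. -/
def perm12 : Perm' := ⟨2, Equiv.refl (Fin 2)⟩
/-- The empty permutation. -/
def emptyPerm : Perm' := ⟨0, Equiv.refl (Fin 0)⟩

/-- The 2×2 grid class `Grid(A,B;C,D)`: `A` top-left, `B` top-right, `C` bottom-left,
`D` bottom-right.  A position `i : Fin n` represents position `i+1`, so "position `≤ v`"
is `(i:ℕ) < v`, and "value `> h`" is `h ≤ (π.2 i : ℕ)`. -/
def GridClass (A B C D : Set Perm') : Set Perm' :=
  {π | ∃ v h : ℕ, v ≤ π.1 ∧ h ≤ π.1 ∧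
    PatternIn π {i | (i : ℕ) < v ∧ h ≤ (π.2 i : ℕ)} A ∧
    PatternIn π {i | v ≤ (i : ℕ) ∧ h ≤ (π.2 i : ℕ)} B ∧
    PatternIn π {i | (i : ℕ) < v ∧ (π.2 i : ℕ) < h} C ∧
    PatternIn π {i | v ≤ (i : ℕ) ∧ (π.2 i : ℕ) < h} D}

/-- Horizontal juxtaposition of `X` (left) and `Y` (right). -/
def HJuxt (X Y : Set Perm') : Set Perm' :=
  {π | ∃ v : ℕ, v ≤ π.1 ∧
    PatternIn π {i | (i : ℕ) < v} X ∧
    PatternIn π {i | v ≤ (i : ℕ)} Y}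

/-- Vertical juxtaposition of `X` (top) and `Y` (bottom). -/
def VJuxt (X Y : Set Perm') : Set Perm' :=
  {π | ∃ h : ℕ, h ≤ π.1 ∧
    PatternIn π {i | h ≤ (π.2 i : ℕ)} X ∧
    PatternIn π {i | (π.2 i : ℕ) < h} Y}

/-- `Squint≤(A,B;C,D)`: divisions `(v, ℓ, r)` with the left h-line `ℓ` no higher
than the right h-line `r`. -/
def SquintLE (A B C D : Set Perm') : Set Perm' :=
  {π | ∃ v l r : ℕ, v ≤ π.1 ∧ l ≤ π.1 ∧ r ≤ π.1 ∧ l ≤ r ∧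
    PatternIn π {i | (i : ℕ) < v ∧ l ≤ (π.2 i : ℕ)} A ∧
    PatternIn π {i | (i : ℕ) < v ∧ (π.2 i : ℕ) < l} C ∧
    PatternIn π {i | v ≤ (i : ℕ) ∧ r ≤ (π.2 i : ℕ)} B ∧
    PatternIn π {i | v ≤ (i : ℕ) ∧ (π.2 i : ℕ) < r} D}

/-- `Squint≥(A,B;C,D)`: divisions `(v, ℓ, r)` with the left h-line `ℓ` no lower
than the right h-line `r`. -/
def SquintGE (A B C D : Set Perm') : Set Perm' :=
  {π | ∃ v l r : ℕ, v ≤ π.1 ∧ l ≤ π.1 ∧ r ≤ π.1 ∧ r ≤ l ∧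
    PatternIn π {i | (i : ℕ) < v ∧ l ≤ (π.2 i : ℕ)} A ∧
    PatternIn π {i | (i : ℕ) < v ∧ (π.2 i : ℕ) < l} C ∧
    PatternIn π {i | v ≤ (i : ℕ) ∧ r ≤ (π.2 i : ℕ)} B ∧
    PatternIn π {i | v ≤ (i : ℕ) ∧ (π.2 i : ℕ) < r} D}

/-- The basis of a set `X`: minimal permutations not in `X`. -/
def PermBasis (X : Set Perm') : Set Perm' :=
  {π | π ∉ X ∧ ∀ σ : Perm', Contains σ π → σ ≠ π → σ ∈ X}

section comb

set_option linter.unusedSectionVars false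

variable {P : Type} [Finite P] [DecidableEq P]

/-- Increasing (`s = true`) or decreasing (`s = false`) pairs of points. -/
def Pr (s : Bool) (x y : P → ℤ) : Set (Finset P) :=
  {T | ∃ p q, T = {p, q} ∧ x p < x q ∧ (if s then y p < y q else y q < y p)}

lemma Pr_neg (s : Bool) (x y : P → ℤ) : Pr (!s) (fun p => - x p) y = Pr s x y := by
  ext T
  constructor
  · rintro ⟨p, q, rfl, h1, h2⟩
    refine ⟨q, p, Finset.pair_comm _ _, by simpa using h1, ?_⟩
    cases s <;> simpa using h2
  · rintro ⟨p, q, rfl, h1, h2⟩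
    refine ⟨q, p, Finset.pair_comm _ _, by simpa using h1, ?_⟩
    cases s <;> simpa using h2

lemma Pr_card {s : Bool} {x y : P → ℤ} {U : Finset P} (h : U ∈ Pr s x y) : U.card ≤ 2 := by
  obtain ⟨p, q, rfl, -⟩ := h
  exact Finset.card_le_two

lemma Pr_nonempty {s : Bool} {x y : P → ℤ} {U : Finset P} (h : U ∈ Pr s x y) : U.Nonempty := by
  obtain ⟨p, q, rfl, -⟩ := h
  exact ⟨p, by simp⟩

/-- If all `v ∈ [a,b]` are covered by a pair consisting of a member of `F` to the top left and a
bad pair to the bottom right, then boundedly many points suffice. -/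
lemma core (sL sR : Bool) (x y : P → ℤ) (hx : Function.Injective x) (hy : Function.Injective y)
    (F : Set (Finset P)) (K : ℕ) (hK : ∀ T ∈ F, T.card ≤ K) (hne : ∀ T ∈ F, T.Nonempty) (a b : ℤ)
    (hcov : ∀ v, a ≤ v → v ≤ b → ∃ T ∈ F, ∃ U ∈ Pr sR x y,
      (∀ t ∈ T, x t < v) ∧ (∀ u ∈ U, v ≤ x u) ∧ ∀ t ∈ T, ∀ u ∈ U, y u ≤ y t)
    (hno : ∀ T ∈ F, ∀ U ∈ Pr sL x y,
      (∀ t ∈ T, x t < b) → (∀ u ∈ U, x u < b) → (∀ t ∈ T, ∀ u ∈ U, y u ≤ y t) → False) :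
    ∃ S : Finset P, S.card ≤ 2 * (K + 2) ∧ ∀ v, a ≤ v → v ≤ b → ∃ T ∈ F, ∃ U ∈ Pr sR x y,
      T ⊆ S ∧ U ⊆ S ∧
      (∀ t ∈ T, x t < v) ∧ (∀ u ∈ U, v ≤ x u) ∧ ∀ t ∈ T, ∀ u ∈ U, y u ≤ y t := by
  rcases lt_or_ge b a with hab | hab
  · exact ⟨∅, by simp, fun v h1 h2 => by omega⟩
  have single : ∀ T ∈ F, ∀ U ∈ Pr sR x y, (∀ t ∈ T, x t < a) → (∀ u ∈ U, b ≤ x u) →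
      (∀ t ∈ T, ∀ u ∈ U, y u ≤ y t) →
      ∃ S : Finset P, S.card ≤ 2 * (K + 2) ∧ ∀ v, a ≤ v → v ≤ b → ∃ T ∈ F, ∃ U ∈ Pr sR x y,
      T ⊆ S ∧ U ⊆ S ∧
      (∀ t ∈ T, x t < v) ∧ (∀ u ∈ U, v ≤ x u) ∧ ∀ t ∈ T, ∀ u ∈ U, y u ≤ y t := by
    intro T hT U hU h1 h2 h3
    refine ⟨T ∪ U, ?_, fun v hav hvb => ⟨T, hT, U, hU, Finset.subset_union_left,
      Finset.subset_union_right, fun t ht => (h1 t ht).trans_le hav,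
      fun u hu => hvb.trans (h2 u hu), h3⟩⟩
    have := Finset.card_union_le T U
    have := hK T hT
    have := Pr_card hU
    omega
  cases sL with
  | false =>
    obtain ⟨T, hT, U, hU, h1, h2, h3⟩ := hcov a le_rfl hab
    refine single T hT U hU h1 ?_ h3
    intro u hu
    by_contra hub
    push Not at hub
    obtain ⟨t, ht, hmin⟩ := Finset.exists_min_image T y (hne T hT)
    have htu : x t < x u := (h1 t ht).trans_le (h2 u hu)
    have hyut : y u < y t := lt_of_le_of_ne (h3 t ht u hu) (fun h => by
      have := hy h; subst this; exact lt_irrefl _ htu)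
    refine hno T hT {t, u} ⟨t, u, rfl, htu, by simpa using hyut⟩
      (fun s hs => (h1 s hs).trans_le hab) ?_ ?_
    · simp only [Finset.mem_insert, Finset.mem_singleton]
      rintro w (rfl | rfl)
      · exact htu.trans hub
      · exact hub
    · simp only [Finset.mem_insert, Finset.mem_singleton]
      rintro s hs w (rfl | rfl)
      · exact hmin s hs
      · exact h3 s hs w hu
  | true =>
    let M : Set P := {p | ∃ T ∈ F, ∃ q, x p < x q ∧ (if sR then y p < y q else y q < y p) ∧
      (∀ t ∈ T, x t < a) ∧ a ≤ x p ∧ ∀ t ∈ T, y p ≤ y t ∧ y q ≤ y t}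
    have hMne : M.Nonempty := by
      obtain ⟨T, hT, U, ⟨p, q, rfl, hpq, hr⟩, h1, h2, h3⟩ := hcov a le_rfl hab
      exact ⟨p, T, hT, q, hpq, hr, h1, h2 p (by simp), fun t ht =>
        ⟨h3 t ht p (by simp), h3 t ht q (by simp)⟩⟩
    obtain ⟨p, ⟨T, hT, q, hpq, hr, h1, hap, h3⟩, hmax⟩ :=
      Set.exists_max_image M x (Set.toFinite M) hMne
    have h3' : ∀ t ∈ T, ∀ u ∈ ({p, q} : Finset P), y u ≤ y t := by
      simp only [Finset.mem_insert, Finset.mem_singleton]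
      rintro s hs w (rfl | rfl)
      · exact (h3 s hs).1
      · exact (h3 s hs).2
    rcases le_or_gt b (x p) with hbp | hbp
    · refine single T hT {p, q} ⟨p, q, rfl, hpq, hr⟩ h1 ?_ h3'
      simp only [Finset.mem_insert, Finset.mem_singleton]
      rintro w (rfl | rfl)
      · exact hbp
      · exact hbp.trans hpq.le
    obtain ⟨T2, hT2, U2, ⟨p2, q2, rfl, hpq2, hr2⟩, k1, k2, k3⟩ :=
      hcov (x p + 1) (by omega) (by omega)
    have hpp2 : x p + 1 ≤ x p2 := k2 p2 (by simp)
    have hbp2 : b ≤ x p2 := by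
      by_contra hbp2
      push Not at hbp2
      have hyp : y p2 < y p := by
        by_contra hyp
        push Not at hyp
        have hyp' : y p < y p2 := lt_of_le_of_ne hyp (fun h => by
          have := hy h; subst this; omega)
        refine hno T2 hT2 {p, p2} ⟨p, p2, rfl, by omega, by simpa using hyp'⟩
          (fun t ht => by have := k1 t ht; omega) ?_ ?_
        · simp only [Finset.mem_insert, Finset.mem_singleton]
          rintro w (rfl | rfl) <;> assumption
        · simp only [Finset.mem_insert, Finset.mem_singleton]
          have : ∀ t ∈ T2, y p2 ≤ y t := fun t ht => k3 t ht p2 (by simp)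
          rintro s hs w (rfl | rfl)
          · exact hyp.trans (this s hs)
          · exact this s hs
      have hp2M : p2 ∈ M := by
        cases sR with
        | false =>
          simp only [Bool.false_eq_true, if_false] at hr2
          refine ⟨T, hT, q2, hpq2, by simpa using hr2, h1, by omega, fun t ht => ?_⟩
          have := (h3 t ht).1
          constructor <;> omega
        | true =>
          simp only [if_true] at hr
          have hbq : b ≤ x q := by
            by_contra hbq
            push Not at hbq
            refine hno T hT {p, q} ⟨p, q, rfl, hpq, by simpa using hr⟩
              (fun t ht => by have := h1 t ht; omega) ?_ h3'
            simp only [Finset.mem_insert, Finset.mem_singleton]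
            rintro w (rfl | rfl) <;> assumption
          refine ⟨T, hT, q, by omega, by simp only [if_true]; omega, h1, by omega, fun t ht => ?_⟩
          have := h3 t ht
          constructor <;> omega
      have := hmax p2 hp2M
      omega
    refine ⟨(T ∪ {p, q}) ∪ (T2 ∪ {p2, q2}), ?_, fun v hav hvb => ?_⟩
    · have := Finset.card_union_le (T ∪ {p, q}) (T2 ∪ {p2, q2})
      have := Finset.card_union_le T {p, q}
      have := Finset.card_union_le T2 {p2, q2}
      have := hK T hT
      have := hK T2 hT2
      have := Finset.card_le_two (a := p) (b := q)
      have := Finset.card_le_two (a := p2) (b := q2)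
      omega
    · rcases le_or_gt v (x p) with hvp | hvp
      · refine ⟨T, hT, {p, q}, ⟨p, q, rfl, hpq, hr⟩, by grind, by grind,
          fun t ht => (h1 t ht).trans_le hav, ?_, h3'⟩
        simp only [Finset.mem_insert, Finset.mem_singleton]
        rintro w (rfl | rfl) <;> omega
      · refine ⟨T2, hT2, {p2, q2}, ⟨p2, q2, rfl, hpq2, hr2⟩, by grind, by grind,
          fun t ht => by have := k1 t ht; omega, ?_, k3⟩
        simp only [Finset.mem_insert, Finset.mem_singleton]
        rintro w (rfl | rfl) <;> omega

/-- The cell obstruction: `S` contains an obstruction to the gridding `(v,h)`. -/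
def Obs (F G L R : Set (Finset P)) (x y : P → ℤ) (S : Finset P) (v h : ℤ) : Prop :=
  (∃ T ∈ F, T ⊆ S ∧ ∀ t ∈ T, x t < v ∧ h ≤ y t) ∨
  (∃ T ∈ G, T ⊆ S ∧ ∀ t ∈ T, v ≤ x t ∧ h ≤ y t) ∨
  (∃ T ∈ L, T ⊆ S ∧ ∀ t ∈ T, x t < v ∧ y t < h) ∨
  (∃ T ∈ R, T ⊆ S ∧ ∀ t ∈ T, v ≤ x t ∧ y t < h)

/-- A pair of obstructions inside `S` ruling out the vertical line `v`. -/
def Cov (F G L R : Set (Finset P)) (x y : P → ℤ) (S : Finset P) (v : ℤ) : Prop :=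
  ∃ T U : Finset P, T ⊆ S ∧ U ⊆ S ∧
    ((T ∈ F ∧ ∀ t ∈ T, x t < v) ∨ (T ∈ G ∧ ∀ t ∈ T, v ≤ x t)) ∧
    ((U ∈ L ∧ ∀ t ∈ U, x t < v) ∨ (U ∈ R ∧ ∀ t ∈ U, v ≤ x t)) ∧
    ∀ t ∈ T, ∀ u ∈ U, y u ≤ y t

lemma Cov.obs {F G L R : Set (Finset P)} {x y : P → ℤ} {S : Finset P} {v : ℤ}
    (hc : Cov F G L R x y S v) (h : ℤ) : Obs F G L R x y S v h := by
  obtain ⟨T, U, hTS, hUS, hT, hU, hTU⟩ := hc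
  by_cases hh : ∀ t ∈ T, h ≤ y t
  · rcases hT with ⟨hT, h1⟩ | ⟨hT, h1⟩
    · exact Or.inl ⟨T, hT, hTS, fun t ht => ⟨h1 t ht, hh t ht⟩⟩
    · exact Or.inr (Or.inl ⟨T, hT, hTS, fun t ht => ⟨h1 t ht, hh t ht⟩⟩)
  · push Not at hh
    obtain ⟨t, ht, hth⟩ := hh
    rcases hU with ⟨hU, h1⟩ | ⟨hU, h1⟩
    · exact Or.inr (Or.inr (Or.inl ⟨U, hU, hUS,
        fun u hu => ⟨h1 u hu, (hTU t ht u hu).trans_lt hth⟩⟩))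
    · exact Or.inr (Or.inr (Or.inr ⟨U, hU, hUS,
        fun u hu => ⟨h1 u hu, (hTU t ht u hu).trans_lt hth⟩⟩))

lemma Cov.mono {F G L R : Set (Finset P)} {x y : P → ℤ} {S S' : Finset P} {v : ℤ}
    (hc : Cov F G L R x y S v) (h : S ⊆ S') : Cov F G L R x y S' v := by
  obtain ⟨T, U, hTS, hUS, h'⟩ := hc
  exact ⟨T, U, hTS.trans h, hUS.trans h, h'⟩

lemma cov_of_obs {F G L R : Set (Finset P)} {x y : P → ℤ} {S : Finset P} {v : ℤ} (n : ℕ)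
    (hy : ∀ p, 0 ≤ y p ∧ y p < n)
    (hF : ∀ T ∈ F, T.Nonempty) (hG : ∀ T ∈ G, T.Nonempty)
    (hL : ∀ T ∈ L, T.Nonempty) (hR : ∀ T ∈ R, T.Nonempty)
    (ho : ∀ h : ℤ, Obs F G L R x y S v h) : Cov F G L R x y S v := by
  let Q : ℕ → Prop := fun h => ∃ T ⊆ S,
    ((T ∈ F ∧ ∀ t ∈ T, x t < v) ∨ (T ∈ G ∧ ∀ t ∈ T, v ≤ x t)) ∧ ∀ t ∈ T, (h : ℤ) ≤ y t
  have hQ : ∀ h : ℕ, ¬ Q h → ∃ U ⊆ S,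
      ((U ∈ L ∧ ∀ t ∈ U, x t < v) ∨ (U ∈ R ∧ ∀ t ∈ U, v ≤ x t)) ∧ ∀ t ∈ U, y t < (h : ℤ) := by
    intro h hq
    rcases ho h with ⟨T, hT, hS, h1⟩ | ⟨T, hT, hS, h1⟩ | ⟨T, hT, hS, h1⟩ | ⟨T, hT, hS, h1⟩
    · exact absurd ⟨T, hS, Or.inl ⟨hT, fun t ht => (h1 t ht).1⟩, fun t ht => (h1 t ht).2⟩ hq
    · exact absurd ⟨T, hS, Or.inr ⟨hT, fun t ht => (h1 t ht).1⟩, fun t ht => (h1 t ht).2⟩ hq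
    · exact ⟨T, hS, Or.inl ⟨hT, fun t ht => (h1 t ht).1⟩, fun t ht => (h1 t ht).2⟩
    · exact ⟨T, hS, Or.inr ⟨hT, fun t ht => (h1 t ht).1⟩, fun t ht => (h1 t ht).2⟩
  have h0 : Q 0 := by
    by_contra h
    obtain ⟨U, -, hU, hlt⟩ := hQ 0 h
    have : U.Nonempty := by
      rcases hU with ⟨hU, -⟩ | ⟨hU, -⟩
      · exact hL U hU
      · exact hR U hU
    obtain ⟨u, hu⟩ := this
    have := hlt u hu
    have := (hy u).1
    push_cast at *
    omega
  have hn : ¬ Q n := by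
    rintro ⟨T, -, hT, hle⟩
    have : T.Nonempty := by
      rcases hT with ⟨hT, -⟩ | ⟨hT, -⟩
      · exact hF T hT
      · exact hG T hT
    obtain ⟨t, ht⟩ := this
    have := hle t ht
    have := (hy t).2
    omega
  have : ∃ h, Q h ∧ ¬ Q (h + 1) := by
    by_contra hc
    push Not at hc
    exact hn (Nat.rec h0 hc n)
  obtain ⟨h, ⟨T, hTS, hT, hle⟩, hq⟩ := this
  obtain ⟨U, hUS, hU, hlt⟩ := hQ _ hq
  refine ⟨T, U, hTS, hUS, hT, hU, fun t ht u hu => ?_⟩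
  have := hle t ht
  have := hlt u hu
  push_cast at this
  omega

lemma comb_main (sL sR : Bool) (x y : P → ℤ) (hx : Function.Injective x)
    (hy : Function.Injective y) (n : ℕ)
    (hxn : ∀ p, 0 ≤ x p ∧ x p < n) (hyn : ∀ p, 0 ≤ y p ∧ y p < n) (F G : Set (Finset P)) (K : ℕ)
    (hKF : ∀ T ∈ F, T.card ≤ K) (hKG : ∀ T ∈ G, T.card ≤ K) (A : Finset P)
    (ho : ∀ v h : ℤ, Obs F G (Pr sL x y) (Pr sR x y) x y A v h) :
    ∃ S : Finset P, S.card ≤ 4 * (K + 2) ∧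
      ∀ v h : ℤ, Obs F G (Pr sL x y) (Pr sR x y) x y S v h := by
  by_cases hF0 : ∅ ∈ F
  · exact ⟨∅, by simp, fun v h => Or.inl ⟨∅, hF0, by simp, by simp⟩⟩
  by_cases hG0 : ∅ ∈ G
  · exact ⟨∅, by simp, fun v h => Or.inr (Or.inl ⟨∅, hG0, by simp, by simp⟩)⟩
  have hF : ∀ T ∈ F, T.Nonempty := fun T hT =>
    Finset.nonempty_iff_ne_empty.2 (fun h => hF0 (h ▸ hT))
  have hG : ∀ T ∈ G, T.Nonempty := fun T hT =>
    Finset.nonempty_iff_ne_empty.2 (fun h => hG0 (h ▸ hT))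
  have hc : ∀ v, Cov F G (Pr sL x y) (Pr sR x y) x y A v := fun v =>
    cov_of_obs n hyn hF hG (fun _ => Pr_nonempty) (fun _ => Pr_nonempty) (ho v)
  suffices ∃ S : Finset P, S.card ≤ 4 * (K + 2) ∧
      ∀ v : ℤ, Cov F G (Pr sL x y) (Pr sR x y) x y S v by
    obtain ⟨S, hS, h⟩ := this
    exact ⟨S, hS, fun v => (h v).obs⟩
  -- pairs entirely on the left
  let CL : ℤ → Prop := fun v => ∃ T ∈ F, ∃ U ∈ Pr sL x y, (∀ t ∈ T, x t < v) ∧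
    (∀ u ∈ U, x u < v) ∧ ∀ t ∈ T, ∀ u ∈ U, y u ≤ y t
  let DR : ℤ → Prop := fun v => ∃ T ∈ G, ∃ U ∈ Pr sR x y, (∀ t ∈ T, v ≤ x t) ∧
    (∀ u ∈ U, v ≤ x u) ∧ ∀ t ∈ T, ∀ u ∈ U, y u ≤ y t
  have hCLn : CL n := by
    obtain ⟨T, U, -, -, hT, hU, hTU⟩ := hc n
    rcases hT with ⟨hT, h1⟩ | ⟨hT, h1⟩
    · rcases hU with ⟨hU, h2⟩ | ⟨hU, h2⟩
      · exact ⟨T, hT, U, hU, h1, h2, hTU⟩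
      · obtain ⟨u, hu⟩ := Pr_nonempty hU
        have := h2 u hu
        have := (hxn u).2
        omega
    · obtain ⟨u, hu⟩ := hG T hT
      have := h1 u hu
      have := (hxn u).2
      omega
  have hDR0 : DR 0 := by
    obtain ⟨T, U, -, -, hT, hU, hTU⟩ := hc 0
    rcases hT with ⟨hT, h1⟩ | ⟨hT, h1⟩
    · obtain ⟨u, hu⟩ := hF T hT
      have := h1 u hu
      have := (hxn u).1
      omega
    · rcases hU with ⟨hU, h2⟩ | ⟨hU, h2⟩
      · obtain ⟨u, hu⟩ := Pr_nonempty hU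
        have := h2 u hu
        have := (hxn u).1
        omega
      · exact ⟨T, hT, U, hU, h1, h2, hTU⟩
  obtain ⟨V1, hV1, hV1min⟩ := Int.exists_least_of_bdd (P := CL) ⟨0, by
    rintro v ⟨T, hT, U, hU, h1, -⟩
    obtain ⟨u, hu⟩ := hF T hT
    have := h1 u hu
    have := (hxn u).1
    omega⟩ ⟨_, hCLn⟩
  obtain ⟨V2, hV2, hV2max⟩ := Int.exists_greatest_of_bdd (P := DR) ⟨n, by
    rintro v ⟨T, hT, U, hU, h1, -⟩
    obtain ⟨u, hu⟩ := hG T hT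
    have := h1 u hu
    have := (hxn u).2
    omega⟩ ⟨_, hDR0⟩
  have hnCL : ¬ CL (V1 - 1) := fun h => by have := hV1min _ h; omega
  have hnDR : ¬ DR (V2 + 1) := fun h => by have := hV2max _ h; omega
  -- middle part
  have hmid : ∃ S : Finset P, S.card ≤ 2 * (K + 2) ∧ ∀ v, V2 + 1 ≤ v → v ≤ V1 - 1 →
      Cov F G (Pr sL x y) (Pr sR x y) x y S v := by
    have hcases : ∀ v, V2 + 1 ≤ v → v ≤ V1 - 1 →
        (∃ T ∈ F, ∃ U ∈ Pr sR x y,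
          (∀ t ∈ T, x t < v) ∧ (∀ u ∈ U, v ≤ x u) ∧ ∀ t ∈ T, ∀ u ∈ U, y u ≤ y t) ∨
        (∃ T ∈ G, ∃ U ∈ Pr sL x y,
          (∀ t ∈ T, v ≤ x t) ∧ (∀ u ∈ U, x u < v) ∧ ∀ t ∈ T, ∀ u ∈ U, y u ≤ y t) := by
      intro v hv2 hv1
      obtain ⟨T, U, -, -, ⟨hT, h1⟩ | ⟨hT, h1⟩, ⟨hU, h2⟩ | ⟨hU, h2⟩, hTU⟩ := hc v
      · have := hV1min v ⟨T, hT, U, hU, h1, h2, hTU⟩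
        omega
      · exact Or.inl ⟨T, hT, U, hU, h1, h2, hTU⟩
      · exact Or.inr ⟨T, hT, U, hU, h1, h2, hTU⟩
      · have := hV2max v ⟨T, hT, U, hU, h1, h2, hTU⟩
        omega
    by_cases hall : ∀ v, V2 + 1 ≤ v → v ≤ V1 - 1 → ∃ T ∈ F, ∃ U ∈ Pr sR x y,
          (∀ t ∈ T, x t < v) ∧ (∀ u ∈ U, v ≤ x u) ∧ ∀ t ∈ T, ∀ u ∈ U, y u ≤ y t
    · obtain ⟨S, hS, h⟩ := core sL sR x y hx hy F K hKF hF (V2 + 1) (V1 - 1) hall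
        (fun T hT U hU h1 h2 h3 => hnCL ⟨T, hT, U, hU, h1, h2, h3⟩)
      refine ⟨S, hS, fun v hv2 hv1 => ?_⟩
      obtain ⟨T, hT, U, hU, hTS, hUS, h1, h2, h3⟩ := h v hv2 hv1
      exact ⟨T, U, hTS, hUS, Or.inl ⟨hT, h1⟩, Or.inr ⟨hU, h2⟩, h3⟩
    · have hall2 : ∀ v, V2 + 1 ≤ v → v ≤ V1 - 1 → ∃ T ∈ G, ∃ U ∈ Pr sL x y,
          (∀ t ∈ T, v ≤ x t) ∧ (∀ u ∈ U, x u < v) ∧ ∀ t ∈ T, ∀ u ∈ U, y u ≤ y t := by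
        push Not at hall
        obtain ⟨w, hw2, hw1, hw⟩ := hall
        obtain ⟨T', hT', U', hU', h1', h2', h3'⟩ := (hcases w hw2 hw1).resolve_left (by
          rintro ⟨T, hT, U, hU, h1, h2, h3⟩
          obtain ⟨t, ht, u, hu, hlt⟩ := hw T hT U hU h1 h2
          exact absurd (h3 t ht u hu) (not_le.2 hlt))
        intro v hv2 hv1
        refine (hcases v hv2 hv1).resolve_left ?_
        rintro ⟨T, hT, U, hU, h1, h2, h3⟩
        by_cases hq : ∀ t ∈ T, ∀ u ∈ U', y u ≤ y t
        · exact hnCL ⟨T, hT, U', hU', fun t ht => (h1 t ht).trans_le hv1,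
            fun u hu => (h2' u hu).trans_le hw1, hq⟩
        · push Not at hq
          obtain ⟨t, ht, u', hu', hlt⟩ := hq
          refine hnDR ⟨T', hT', U, hU, fun t ht => hw2.trans (h1' t ht),
            fun u hu => hv2.trans (h2 u hu), fun t' ht' u hu => ?_⟩
          have := h3 t ht u hu
          have := h3' t' ht' u' hu'
          omega
      obtain ⟨S, hS, h⟩ := core (!sR) (!sL) (fun p => - x p) y
        (fun p q h => hx (neg_injective h)) hy G K hKG hG (1 - (V1 - 1)) (1 - (V2 + 1))
        (by
          intro v hv2 hv1
          obtain ⟨T, hT, U, hU, h1, h2, h3⟩ := hall2 (1 - v) (by omega) (by omega)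
          rw [Pr_neg]
          refine ⟨T, hT, U, hU, fun t ht => ?_, fun u hu => ?_, h3⟩
          · have := h1 t ht
            omega
          · have := h2 u hu
            omega)
        (by
          rw [Pr_neg]
          intro T hT U hU h1 h2 h3
          refine hnDR ⟨T, hT, U, hU, fun t ht => ?_, fun u hu => ?_, h3⟩
          · have := h1 t ht
            omega
          · have := h2 u hu
            omega)
      rw [Pr_neg] at h
      refine ⟨S, hS, fun v hv2 hv1 => ?_⟩
      obtain ⟨T, hT, U, hU, hTS, hUS, h1, h2, h3⟩ := h (1 - v) (by omega) (by omega)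
      refine ⟨T, U, hTS, hUS, Or.inr ⟨hT, fun t ht => ?_⟩, Or.inl ⟨hU, fun u hu => ?_⟩, h3⟩
      · have := h1 t ht
        omega
      · have := h2 u hu
        omega
  obtain ⟨S, hS, hSc⟩ := hmid
  obtain ⟨T1, hT1, U1, hU1, a1, a2, a3⟩ := hV1
  obtain ⟨T2, hT2, U2, hU2, b1, b2, b3⟩ := hV2
  refine ⟨S ∪ ((T1 ∪ U1) ∪ (T2 ∪ U2)), ?_, fun v => ?_⟩
  · have := Finset.card_union_le S ((T1 ∪ U1) ∪ (T2 ∪ U2))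
    have := Finset.card_union_le (T1 ∪ U1) (T2 ∪ U2)
    have := Finset.card_union_le T1 U1
    have := Finset.card_union_le T2 U2
    have := hKF T1 hT1
    have := hKG T2 hT2
    have := Pr_card hU1
    have := Pr_card hU2
    omega
  · rcases le_or_gt V1 v with h1 | h1
    · exact ⟨T1, U1, by grind, by grind, Or.inl ⟨hT1, fun t ht => (a1 t ht).trans_le h1⟩,
        Or.inl ⟨hU1, fun t ht => (a2 t ht).trans_le h1⟩, a3⟩
    rcases le_or_gt v V2 with h2 | h2
    · exact ⟨T2, U2, by grind, by grind, Or.inr ⟨hT2, fun t ht => h2.trans (b1 t ht)⟩,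
        Or.inr ⟨hU2, fun t ht => h2.trans (b2 t ht)⟩, b3⟩
    exact (hSc v (by omega) (by omega)).mono Finset.subset_union_left

end comb

/-- Position of an entry, as an integer. -/
def xx (π : Perm') : Fin π.1 → ℤ := fun i => ((i : ℕ) : ℤ)

/-- Value of an entry, as an integer. -/
def yy (π : Perm') : Fin π.1 → ℤ := fun i => ((π.2 i : ℕ) : ℤ)

/-- The supports of occurrences of members of `B` in `π`. -/
def Fam (B : Set Perm') (π : Perm') : Set (Finset (Fin π.1)) :=
  {T | ∃ β ∈ B, ∃ g : Fin β.1 → Fin π.1, StrictMono g ∧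
    (∀ i j, β.2 i < β.2 j ↔ π.2 (g i) < π.2 (g j)) ∧ T = Finset.univ.image g}

lemma exists_pattern (π : Perm') (S : Finset (Fin π.1)) :
    ∃ σ : Perm', σ.1 = S.card ∧ PatternOn π S σ := by
  let f := S.orderEmbOfFin rfl
  let S' := S.image π.2
  have hS' : S'.card = S.card := Finset.card_image_of_injective _ π.2.injective
  let e := S'.orderIsoOfFin hS'
  have hmem : ∀ i, π.2 (f i) ∈ S' := fun i =>
    Finset.mem_image_of_mem _ (Finset.orderEmbOfFin_mem S rfl i)
  let g : Fin S.card → Fin S.card := fun i => e.symm ⟨π.2 (f i), hmem i⟩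
  have hg : Function.Injective g := by
    intro i j h
    have h2 := e.symm.injective h
    rw [Subtype.mk.injEq] at h2
    exact f.injective (π.2.injective h2)
  refine ⟨⟨S.card, Equiv.ofBijective g (Finite.injective_iff_bijective.1 hg)⟩, rfl,
    f, f.strictMono, ?_, ?_⟩
  · exact Finset.range_orderEmbOfFin S rfl
  · intro i j
    change g i < g j ↔ _
    simp only [g]
    rw [e.symm.lt_iff_lt, Subtype.mk_lt_mk]

lemma lift_occ {σ π β : Perm'} {f : Fin σ.1 → Fin π.1} (hf : StrictMono f)
    (hfo : ∀ i j, σ.2 i < σ.2 j ↔ π.2 (f i) < π.2 (f j))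
    {g : Fin β.1 → Fin π.1} (hg : StrictMono g)
    (hgo : ∀ i j, β.2 i < β.2 j ↔ π.2 (g i) < π.2 (g j))
    (hr : ∀ i, g i ∈ Set.range f) :
    ∃ k : Fin β.1 → Fin σ.1, StrictMono k ∧
      (∀ i j, β.2 i < β.2 j ↔ σ.2 (k i) < σ.2 (k j)) ∧ ∀ i, f (k i) = g i := by
  choose k hk using hr
  refine ⟨k, fun i j hij => ?_, fun i j => ?_, hk⟩
  · rw [← hf.lt_iff_lt, hk, hk]
    exact hg hij
  · rw [hgo, hfo, hk, hk]

lemma patternIn_av (π : Perm') (S : Set (Fin π.1)) (B : Set Perm') :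
    PatternIn π S (Av B) ↔ ¬ ∃ T ∈ Fam B π, ∀ t ∈ T, t ∈ S := by
  classical
  constructor
  · rintro ⟨σ, hσ, f, hf, hr, hfo⟩ ⟨T, ⟨β, hβ, g, hg, hgo, rfl⟩, hT⟩
    obtain ⟨k, hk, hko, -⟩ := lift_occ hf hfo hg hgo (fun i => by
      rw [hr]; exact hT _ (Finset.mem_image_of_mem _ (Finset.mem_univ i)))
    exact hσ β hβ ⟨k, hk, hko⟩
  · intro h
    obtain ⟨σ, -, f, hf, hr, hfo⟩ := exists_pattern π S.toFinset
    rw [Set.coe_toFinset] at hr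
    refine ⟨σ, fun β hβ => ?_, f, hf, hr, hfo⟩
    rintro ⟨k, hk, hko⟩
    refine h ⟨_, ⟨β, hβ, f ∘ k, hf.comp hk, fun i j => ?_, rfl⟩, ?_⟩
    · rw [hko, hfo]; rfl
    · simp only [Finset.mem_image, Finset.mem_univ, true_and]
      rintro t ⟨i, rfl⟩
      rw [← hr]
      exact ⟨k i, rfl⟩

/-- Obstruction predicate for the grid class of `Av B1, Av B2, Av B3, Av B4`. -/
def PObs (B1 B2 B3 B4 : Set Perm') (π : Perm') (S : Finset (Fin π.1)) (v h : ℤ) : Prop :=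
  Obs (Fam B1 π) (Fam B2 π) (Fam B3 π) (Fam B4 π) (xx π) (yy π) S v h

lemma mem_grid_iff (B1 B2 B3 B4 : Set Perm') (π : Perm') :
    π ∈ GridClass (Av B1) (Av B2) (Av B3) (Av B4) ↔
      ∃ v h : ℤ, ¬ PObs B1 B2 B3 B4 π Finset.univ v h := by
  constructor
  · rintro ⟨v, h, hv, hh, h1, h2, h3, h4⟩
    rw [patternIn_av] at h1 h2 h3 h4
    refine ⟨v, h, ?_⟩
    rintro (⟨T, hT, -, H⟩ | ⟨T, hT, -, H⟩ | ⟨T, hT, -, H⟩ | ⟨T, hT, -, H⟩)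
    · exact h1 ⟨T, hT, fun t ht => by simpa [xx, yy] using H t ht⟩
    · exact h2 ⟨T, hT, fun t ht => by simpa [xx, yy] using H t ht⟩
    · exact h3 ⟨T, hT, fun t ht => by simpa [xx, yy] using H t ht⟩
    · exact h4 ⟨T, hT, fun t ht => by simpa [xx, yy] using H t ht⟩
  · rintro ⟨v, h, H⟩
    refine ⟨(min v π.1).toNat, (min h π.1).toNat, by omega, by omega, ?_⟩
    simp only [patternIn_av]
    have e1 : ∀ i : Fin π.1, (i : ℕ) < (min v π.1).toNat ↔ xx π i < v := by
      intro i; have := i.2; simp only [xx]; omega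
    have e2 : ∀ i : Fin π.1, (min v π.1).toNat ≤ (i : ℕ) ↔ v ≤ xx π i := by
      intro i; have := i.2; simp only [xx]; omega
    have e3 : ∀ i : Fin π.1, (π.2 i : ℕ) < (min h π.1).toNat ↔ yy π i < h := by
      intro i; have := (π.2 i).2; simp only [yy]; omega
    have e4 : ∀ i : Fin π.1, (min h π.1).toNat ≤ (π.2 i : ℕ) ↔ h ≤ yy π i := by
      intro i; have := (π.2 i).2; simp only [yy]; omega
    simp only [e1, e2, e3, e4, Set.mem_ofPred_eq]
    refine ⟨?_, ?_, ?_, ?_⟩ <;> rintro ⟨T, hT, h'⟩ <;> apply H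
    · exact Or.inl ⟨T, hT, Finset.subset_univ _, h'⟩
    · exact Or.inr (Or.inl ⟨T, hT, Finset.subset_univ _, h'⟩)
    · exact Or.inr (Or.inr (Or.inl ⟨T, hT, Finset.subset_univ _, h'⟩))
    · exact Or.inr (Or.inr (Or.inr ⟨T, hT, Finset.subset_univ _, h'⟩))

lemma cell_iff {σ π : Perm'} {f : Fin σ.1 → Fin π.1} (hf : StrictMono f)
    (hfo : ∀ i j, σ.2 i < σ.2 j ↔ π.2 (f i) < π.2 (f j)) (B : Set Perm')
    (p : Fin σ.1 → Prop) (q : Fin π.1 → Prop) (hpq : ∀ i, p i ↔ q (f i)) :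
    (∃ T ∈ Fam B σ, T ⊆ Finset.univ ∧ ∀ t ∈ T, p t) ↔
      ∃ T ∈ Fam B π, T ⊆ Finset.univ.image f ∧ ∀ t ∈ T, q t := by
  constructor
  · rintro ⟨_, ⟨β, hβ, g, hg, hgo, rfl⟩, -, h⟩
    refine ⟨_, ⟨β, hβ, f ∘ g, hf.comp hg, fun i j => ?_, rfl⟩, ?_, ?_⟩
    · rw [hgo, hfo]; rfl
    · intro t ht
      simp only [Finset.mem_image, Finset.mem_univ, true_and] at ht ⊢
      obtain ⟨i, rfl⟩ := ht
      exact ⟨g i, rfl⟩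
    · intro t ht
      simp only [Finset.mem_image, Finset.mem_univ, true_and] at ht
      obtain ⟨i, rfl⟩ := ht
      exact (hpq _).1 (h _ (Finset.mem_image_of_mem _ (Finset.mem_univ i)))
  · rintro ⟨_, ⟨β, hβ, g, hg, hgo, rfl⟩, hS, h⟩
    obtain ⟨k, hk, hko, hfk⟩ := lift_occ hf hfo hg hgo (fun i => by
      have := hS (Finset.mem_image_of_mem _ (Finset.mem_univ i))
      simpa using this)
    refine ⟨_, ⟨β, hβ, k, hk, hko, rfl⟩, Finset.subset_univ _, ?_⟩
    intro t ht
    simp only [Finset.mem_image, Finset.mem_univ, true_and] at ht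
    obtain ⟨i, rfl⟩ := ht
    rw [hpq, hfk]
    exact h _ (Finset.mem_image_of_mem _ (Finset.mem_univ i))

lemma pobs_iff {σ π : Perm'} {f : Fin σ.1 → Fin π.1} (hf : StrictMono f)
    (hfo : ∀ i j, σ.2 i < σ.2 j ↔ π.2 (f i) < π.2 (f j)) (B1 B2 B3 B4 : Set Perm')
    (v h v' h' : ℤ) (hv : ∀ i, xx σ i < v' ↔ xx π (f i) < v)
    (hh : ∀ i, yy σ i < h' ↔ yy π (f i) < h) :
    PObs B1 B2 B3 B4 σ Finset.univ v' h' ↔ PObs B1 B2 B3 B4 π (Finset.univ.image f) v h := by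
  have hv2 : ∀ i, v' ≤ xx σ i ↔ v ≤ xx π (f i) := fun i => by
    rw [← not_lt, ← not_lt, hv]
  have hh2 : ∀ i, h' ≤ yy σ i ↔ h ≤ yy π (f i) := fun i => by
    rw [← not_lt, ← not_lt, hh]
  unfold PObs Obs
  refine or_congr ?_ (or_congr ?_ (or_congr ?_ ?_))
  · exact cell_iff hf hfo B1 _ _ (fun i => and_congr (hv i) (hh2 i))
  · exact cell_iff hf hfo B2 _ _ (fun i => and_congr (hv2 i) (hh2 i))
  · exact cell_iff hf hfo B3 _ _ (fun i => and_congr (hv i) (hh i))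
  · exact cell_iff hf hfo B4 _ _ (fun i => and_congr (hv2 i) (hh i))

lemma line_pull {m : ℕ} (e : Fin m → ℤ) (he : StrictMono e) (v : ℤ) :
    ∃ v' : ℤ, ∀ i : Fin m, ((i : ℕ) : ℤ) < v' ↔ e i < v := by
  by_cases h : ∀ i, e i < v
  · exact ⟨m, fun i => by simp [h i]⟩
  · push Not at h
    obtain ⟨i, hi, hmin⟩ := Set.exists_min_image {i | v ≤ e i} id (Set.toFinite _) h
    refine ⟨(i : ℕ), fun j => ?_⟩
    simp only [Nat.cast_lt]
    constructor
    · intro hj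
      by_contra hc
      have := hmin j (not_lt.1 hc)
      exact absurd this (not_le.2 hj)
    · intro hj
      by_contra hc
      have : i ≤ j := not_lt.1 hc
      have := he.monotone this
      have hi' : v ≤ e i := hi
      omega

lemma line_push {m : ℕ} (e : Fin m → ℤ) (he : StrictMono e) (v' : ℤ) :
    ∃ v : ℤ, ∀ i : Fin m, ((i : ℕ) : ℤ) < v' ↔ e i < v := by
  by_cases h : ∃ i : Fin m, v' ≤ ((i : ℕ) : ℤ)
  · obtain ⟨i, hi, hmin⟩ :=
      Set.exists_min_image {i : Fin m | v' ≤ ((i : ℕ) : ℤ)} id (Set.toFinite _) h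
    refine ⟨e i, fun j => ?_⟩
    rw [he.lt_iff_lt]
    constructor
    · intro hj
      have hi' : v' ≤ ((i : ℕ) : ℤ) := hi
      rw [Fin.lt_def]
      omega
    · intro hj
      by_contra hc
      have := hmin j (not_lt.1 hc)
      exact absurd this (not_le.2 hj)
  · push Not at h
    obtain ⟨M, hM⟩ := (Set.toFinite (Set.range e)).bddAbove
    refine ⟨M + 1, fun i => ?_⟩
    have h1 := hM ⟨i, rfl⟩
    have h2 := h i
    constructor <;> intro <;> omega

lemma xx_strictMono {σ π : Perm'} {f : Fin σ.1 → Fin π.1} (hf : StrictMono f) :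
    StrictMono (fun i => xx π (f i)) := by
  intro i j hij
  have := hf hij
  simp only [xx]
  exact_mod_cast this

lemma yy_strictMono {σ π : Perm'} {f : Fin σ.1 → Fin π.1}
    (hfo : ∀ i j, σ.2 i < σ.2 j ↔ π.2 (f i) < π.2 (f j)) :
    StrictMono (fun i => yy π (f (σ.2.symm i))) := by
  intro i j hij
  have := (hfo (σ.2.symm i) (σ.2.symm j)).1 (by simpa using hij)
  simp only [yy]
  exact_mod_cast this

lemma PObs.mono {B1 B2 B3 B4 : Set Perm'} {π : Perm'} {S S' : Finset (Fin π.1)} {v h : ℤ}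
    (H : PObs B1 B2 B3 B4 π S v h) (hS : S ⊆ S') : PObs B1 B2 B3 B4 π S' v h := by
  rcases H with ⟨T, hT, h1, h2⟩ | ⟨T, hT, h1, h2⟩ | ⟨T, hT, h1, h2⟩ | ⟨T, hT, h1, h2⟩
  · exact Or.inl ⟨T, hT, h1.trans hS, h2⟩
  · exact Or.inr (Or.inl ⟨T, hT, h1.trans hS, h2⟩)
  · exact Or.inr (Or.inr (Or.inl ⟨T, hT, h1.trans hS, h2⟩))
  · exact Or.inr (Or.inr (Or.inr ⟨T, hT, h1.trans hS, h2⟩))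

lemma grid_down (B1 B2 B3 B4 : Set Perm') {σ π : Perm'}
    (hπ : π ∈ GridClass (Av B1) (Av B2) (Av B3) (Av B4)) (hc : Contains σ π) :
    σ ∈ GridClass (Av B1) (Av B2) (Av B3) (Av B4) := by
  rw [mem_grid_iff] at *
  obtain ⟨v, h, H⟩ := hπ
  obtain ⟨f, hf, hfo⟩ := hc
  obtain ⟨v', hv'⟩ := line_pull _ (xx_strictMono hf) v
  obtain ⟨h', hh'⟩ := line_pull _ (yy_strictMono hfo) h
  refine ⟨v', h', fun hO => H ?_⟩
  refine ((pobs_iff hf hfo B1 B2 B3 B4 v h v' h' hv' (fun i => ?_)).1 hO).mono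
    (Finset.subset_univ _)
  simpa [yy] using hh' (σ.2 i)

lemma grid_extract (B1 B2 B3 B4 : Set Perm') {π : Perm'} (S : Finset (Fin π.1))
    (hS : ∀ v h : ℤ, PObs B1 B2 B3 B4 π S v h) :
    ∃ σ : Perm', σ.1 = S.card ∧ Contains σ π ∧
      σ ∉ GridClass (Av B1) (Av B2) (Av B3) (Av B4) := by
  obtain ⟨σ, hc, f, hf, hr, hfo⟩ := exists_pattern π S
  refine ⟨σ, hc, ⟨f, hf, hfo⟩, ?_⟩
  rw [mem_grid_iff]
  rintro ⟨v', h', H⟩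
  obtain ⟨v, hv⟩ := line_push _ (xx_strictMono hf) v'
  obtain ⟨h, hh⟩ := line_push _ (yy_strictMono hfo) h'
  refine H ((pobs_iff hf hfo B1 B2 B3 B4 v h v' h' hv (fun i => ?_)).2 ((hS v h).mono ?_))
  · simpa [yy] using hh (σ.2 i)
  · intro s hs
    have : s ∈ Set.range f := by rw [hr]; exact hs
    simpa using this

/-- The pattern of length two with the given sign. -/
def pat (s : Bool) : Perm' := if s then perm12 else perm21

lemma fam_pat (s : Bool) (π : Perm') : Fam {pat s} π = Pr s (xx π) (yy π) := by
  ext T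
  constructor
  · rintro ⟨β, hβ, g, hg, hgo, rfl⟩
    rw [Set.mem_singleton_iff] at hβ
    subst hβ
    cases s with
    | false =>
      change Fin 2 → _ at g
      refine ⟨g 0, g 1, ?_, ?_, ?_⟩
      · change Finset.image g (Finset.univ : Finset (Fin 2)) = _
        ext t; simp [Finset.mem_image, Fin.exists_fin_two, eq_comm]
      · have := hg (show (0 : Fin 2) < 1 by decide)
        simp only [xx]; exact_mod_cast this
      · have := (hgo (1 : Fin 2) (0 : Fin 2)).1 (by
          change (Equiv.swap (0 : Fin 2) 1) 1 < (Equiv.swap (0 : Fin 2) 1) 0; decide)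
        simp only [yy, Bool.false_eq_true, if_false]; exact_mod_cast this
    | true =>
      change Fin 2 → _ at g
      refine ⟨g 0, g 1, ?_, ?_, ?_⟩
      · change Finset.image g (Finset.univ : Finset (Fin 2)) = _
        ext t; simp [Finset.mem_image, Fin.exists_fin_two, eq_comm]
      · have := hg (show (0 : Fin 2) < 1 by decide)
        simp only [xx]; exact_mod_cast this
      · have := (hgo (0 : Fin 2) (1 : Fin 2)).1 (by
          change (0 : Fin 2) < 1; decide)
        simp only [yy, if_true]; exact_mod_cast this
  · rintro ⟨p, q, rfl, hpq, hr⟩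
    have hpq' : p < q := by simpa [xx] using hpq
    have hmono : StrictMono (![p, q] : Fin 2 → Fin π.1) := by
      intro i j hij
      fin_cases i <;> fin_cases j <;> simp_all
    refine ⟨pat s, rfl, ?_⟩
    cases s with
    | false =>
      have hr' : π.2 q < π.2 p := by simpa [yy] using hr
      refine ⟨(![p, q] : Fin 2 → Fin π.1), hmono, ?_, ?_⟩
      · change ∀ i j : Fin 2, (Equiv.swap (0 : Fin 2) 1) i < (Equiv.swap (0 : Fin 2) 1) j ↔ _
        intro i j
        fin_cases i <;> fin_cases j <;> simp [hr', hr'.le]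
      · change _ = Finset.image (![p, q] : Fin 2 → Fin π.1) (Finset.univ : Finset (Fin 2))
        ext t; simp [Finset.mem_image, Fin.exists_fin_two, eq_comm]
    | true =>
      have hr' : π.2 p < π.2 q := by simpa [yy] using hr
      refine ⟨(![p, q] : Fin 2 → Fin π.1), hmono, ?_, ?_⟩
      · change ∀ i j : Fin 2, i < j ↔ _
        intro i j
        fin_cases i <;> fin_cases j <;> simp [hr', hr'.le]
      · change _ = Finset.image (![p, q] : Fin 2 → Fin π.1) (Finset.univ : Finset (Fin 2))
        ext t; simp [Finset.mem_image, Fin.exists_fin_two, eq_comm]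

lemma finite_bounded (N : ℕ) : {σ : Perm' | σ.1 ≤ N}.Finite := by
  have : {σ : Perm' | σ.1 ≤ N} ⊆
      Set.range (fun σ : (Σ n : Fin (N + 1), Equiv.Perm (Fin n)) => (⟨σ.1, σ.2⟩ : Perm')) := by
    rintro ⟨n, σ⟩ h
    exact ⟨⟨⟨n, Nat.lt_succ_of_le h⟩, σ⟩, rfl⟩
  exact (Set.finite_range _).subset this

lemma fam_card {B : Set Perm'} {K : ℕ} (hK : ∀ β ∈ B, β.1 ≤ K) (π : Perm') :
    ∀ T ∈ Fam B π, T.card ≤ K := by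
  rintro _ ⟨β, hβ, g, -, -, rfl⟩
  refine Finset.card_image_le.trans ?_
  simpa using hK β hβ

lemma grid_fb (B1 B2 : Set Perm') (h1 : B1.Finite) (h2 : B2.Finite) (sL sR : Bool) :
    FinitelyBased (GridClass (Av B1) (Av B2) (Av {pat sL}) (Av {pat sR})) := by
  obtain ⟨K, hK⟩ : ∃ K, ∀ β ∈ B1 ∪ B2, β.1 ≤ K := by
    obtain ⟨K, hK⟩ := ((h1.union h2).image Sigma.fst).bddAbove
    exact ⟨K, fun β hβ => hK ⟨β, hβ, rfl⟩⟩
  set G := GridClass (Av B1) (Av B2) (Av {pat sL}) (Av {pat sR}) with hG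
  refine ⟨{σ | σ.1 ≤ 4 * (K + 2) ∧ σ ∉ G}, (finite_bounded _).subset (fun σ h => h.1), ?_⟩
  ext π
  constructor
  · intro hπ β hβ hc
    exact hβ.2 (grid_down _ _ _ _ hπ hc)
  · intro hπ
    by_contra hn
    have hO : ∀ v h : ℤ, PObs B1 B2 {pat sL} {pat sR} π Finset.univ v h := by
      intro v h
      by_contra hc
      exact hn ((mem_grid_iff _ _ _ _ _).2 ⟨v, h, hc⟩)
    unfold PObs at hO
    rw [fam_pat, fam_pat] at hO
    obtain ⟨S, hS, H⟩ := comb_main sL sR (xx π) (yy π)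
      (fun i j h => by simpa [xx, Fin.ext_iff] using h)
      (fun i j h => π.2.injective (Fin.ext (by simp only [yy] at h; omega))) π.1
      (fun p => by have := p.2; simp only [xx]; omega)
      (fun p => by have := (π.2 p).2; simp only [yy]; omega)
      (Fam B1 π) (Fam B2 π) K
      (fam_card (fun β hβ => hK β (Or.inl hβ)) π) (fam_card (fun β hβ => hK β (Or.inr hβ)) π)
      Finset.univ hO
    rw [← fam_pat, ← fam_pat] at H
    obtain ⟨σ, hc, hcon, hσ⟩ := grid_extract B1 B2 {pat sL} {pat sR} S H
    exact hπ σ ⟨by omega, hσ⟩ hcon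

/-- For finitely based permutation classes `C`, `D`, the grid classes
`Grid(C,D;Av 21,Av 21)`, `Grid(C,D;Av 21,Av 12)` and `Grid(C,D;Av 12,Av 21)` are
all finitely based. -/
theorem grid2x2_top_CD_finitelyBased (C D : Set Perm')
    (hC : IsPermClass C) (hD : IsPermClass D)
    (hCfb : FinitelyBased C) (hDfb : FinitelyBased D) :
    FinitelyBased (GridClass C D (Av {perm21}) (Av {perm21})) ∧
    FinitelyBased (GridClass C D (Av {perm21}) (Av {perm12})) ∧
    FinitelyBased (GridClass C D (Av {perm12}) (Av {perm21})) := by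
  obtain ⟨B1, h1, rfl⟩ := hCfb
  obtain ⟨B2, h2, rfl⟩ := hDfb
  exact ⟨grid_fb B1 B2 h1 h2 false false, grid_fb B1 B2 h1 h2 false true,
    grid_fb B1 B2 h1 h2 true false⟩
end

section
/- Let C and D be finitely based permutation classes. Then the 2×2 grid class Grid(C,D; Av(21),Av(21)), whose top row is (C, D) and whose bottom row consists of two increasing cells, is finitely based. -/
namespace GridAux

section core

variable {n : ℕ} (π : Equiv.Perm (Fin n)) (FC FD : Set (Finset (Fin n)))

def tl (S : Finset (Fin n)) (v h : ℕ) : Prop :=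
  ∃ T ∈ FC, T ⊆ S ∧ ∀ i ∈ T, (i : ℕ) < v ∧ h ≤ (π i : ℕ)

def tr (S : Finset (Fin n)) (v h : ℕ) : Prop :=
  ∃ T ∈ FD, T ⊆ S ∧ ∀ i ∈ T, v ≤ (i : ℕ) ∧ h ≤ (π i : ℕ)

def bl (S : Finset (Fin n)) (v h : ℕ) : Prop :=
  ∃ p ∈ S, ∃ q ∈ S, p < q ∧ π q < π p ∧ (q : ℕ) < v ∧ (π p : ℕ) < h

def br (S : Finset (Fin n)) (v h : ℕ) : Prop :=
  ∃ p ∈ S, ∃ q ∈ S, p < q ∧ π q < π p ∧ v ≤ (p : ℕ) ∧ (π p : ℕ) < h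

def Obs (S : Finset (Fin n)) (v h : ℕ) : Prop :=
  tl π FC S v h ∨ tr π FD S v h ∨ bl π S v h ∨ br π S v h

lemma Obs.mono {S S' : Finset (Fin n)} (hS : S ⊆ S') {v h : ℕ}
    (H : Obs π FC FD S v h) : Obs π FC FD S' v h := by
  rcases H with ⟨T, hT, hTS, H⟩ | ⟨T, hT, hTS, H⟩ | ⟨p, hp, q, hq, H⟩ | ⟨p, hp, q, hq, H⟩
  · exact Or.inl ⟨T, hT, hTS.trans hS, H⟩
  · exact Or.inr (Or.inl ⟨T, hT, hTS.trans hS, H⟩)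
  · exact Or.inr (Or.inr (Or.inl ⟨p, hS hp, q, hS hq, H⟩))
  · exact Or.inr (Or.inr (Or.inr ⟨p, hS hp, q, hS hq, H⟩))

def Good (K m : ℕ) (Q : ℕ → ℕ → Prop) : Prop :=
  ∃ S : Finset (Fin n), S.card ≤ m * K ∧ ∀ v h, Q v h → Obs π FC FD S v h

variable {π FC FD} {K : ℕ}

lemma Good.union {m m' : ℕ} {Q Q' : ℕ → ℕ → Prop} (H : Good π FC FD K m Q)
    (H' : Good π FC FD K m' Q') : Good π FC FD K (m + m') (fun v h => Q v h ∨ Q' v h) := by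
  obtain ⟨S, hS, H⟩ := H
  obtain ⟨S', hS', H'⟩ := H'
  refine ⟨S ∪ S', ?_, ?_⟩
  · have := Finset.card_union_le S S'
    rw [Nat.add_mul]; omega
  · rintro v h (hq | hq)
    · exact (H v h hq).mono _ _ _ Finset.subset_union_left
    · exact (H' v h hq).mono _ _ _ Finset.subset_union_right

lemma Good.weaken {m : ℕ} {Q Q' : ℕ → ℕ → Prop} (H : Good π FC FD K m Q)
    (h : ∀ v h, Q' v h → Q v h) : Good π FC FD K m Q' := by
  obtain ⟨S, hS, H⟩ := H
  exact ⟨S, hS, fun v k hq => H v k (h v k hq)⟩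

lemma good_tl (hFC : ∀ T ∈ FC, T.card ≤ K) (P : ℕ → Prop) (hP : ∀ v, P v → v ≤ n) (l : ℕ) :
    Good π FC FD K 1 (fun v h => (P v ∧ tl π FC Finset.univ v l) ∧ h ≤ l) := by
  classical
  by_cases hex : ∃ v, P v ∧ tl π FC Finset.univ v l
  · obtain ⟨ha, T, hT, -, H⟩ := Nat.find_spec hex
    refine ⟨T, by simpa using hFC T hT, ?_⟩
    rintro v h ⟨hv, hh⟩
    have := Nat.find_min' hex hv
    exact Or.inl ⟨T, hT, subset_rfl, fun i hi => ⟨(H i hi).1.trans_le this, hh.trans (H i hi).2⟩⟩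
  · exact ⟨∅, by simp, fun v h hv => absurd ⟨v, hv.1⟩ hex⟩

/-- the greatest element of a bounded nonempty predicate -/
lemma exists_greatest {P : ℕ → Prop} (hP : ∀ v, P v → v ≤ n) (hex : ∃ v, P v) :
    ∃ b, P b ∧ ∀ v, P v → v ≤ b := by
  classical
  obtain ⟨v, hv⟩ := hex
  exact ⟨Nat.findGreatest P n, Nat.findGreatest_spec (hP v hv) hv,
    fun w hw => Nat.le_findGreatest (hP w hw) hw⟩

lemma good_tr_pt (hFD : ∀ T ∈ FD, T.card ≤ K) {b l : ℕ} (H : tr π FD Finset.univ b l) :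
    Good π FC FD K 1 (fun v h => v ≤ b ∧ h ≤ l) := by
  obtain ⟨T, hT, -, H⟩ := H
  refine ⟨T, by simpa using hFD T hT, ?_⟩
  rintro v h ⟨hv, hh⟩
  exact Or.inr (Or.inl ⟨T, hT, subset_rfl, fun i hi => ⟨hv.trans (H i hi).1, hh.trans (H i hi).2⟩⟩)

lemma good_bl_pt (hK : 2 ≤ K) {b l : ℕ} (H : bl π Finset.univ b l) :
    Good π FC FD K 1 (fun v h => b ≤ v ∧ l ≤ h) := by
  classical
  obtain ⟨p, -, q, -, h1, h2, h3, h4⟩ := H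
  refine ⟨{p, q}, (Finset.card_le_two).trans (by omega), ?_⟩
  rintro v h ⟨hv, hh⟩
  exact Or.inr (Or.inr (Or.inl ⟨p, by simp, q, by simp, h1, h2, by omega, by omega⟩))

lemma good_br_pt (hK : 2 ≤ K) {b l : ℕ} (H : br π Finset.univ b l) :
    Good π FC FD K 1 (fun v h => v ≤ b ∧ l ≤ h) := by
  classical
  obtain ⟨p, -, q, -, h1, h2, h3, h4⟩ := H
  refine ⟨{p, q}, (Finset.card_le_two).trans (by omega), ?_⟩
  rintro v h ⟨hv, hh⟩
  exact Or.inr (Or.inr (Or.inr ⟨p, by simp, q, by simp, h1, h2, by omega, by omega⟩))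

lemma good_false (m : ℕ) {Q : ℕ → ℕ → Prop} (h : ∀ v h, ¬ Q v h) : Good π FC FD K m Q :=
  ⟨∅, by simp, fun v k hq => absurd hq (h v k)⟩

lemma exists_L (π : Equiv.Perm (Fin n)) : ∃ L : ℕ → ℕ, (∀ v, L v ≤ n) ∧
    ∀ v h, h ≤ n → (bl π Finset.univ v h ↔ L v < h) := by
  classical
  refine ⟨fun v => Nat.findGreatest (fun h => ¬ bl π Finset.univ v h) n,
    fun v => Nat.findGreatest_le _, fun v h hn => ⟨fun H => ?_, fun H => ?_⟩⟩
  · by_contra hc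
    dsimp only at hc
    have h0 : ¬ bl π Finset.univ v 0 := by rintro ⟨p, -, q, -, -, -, -, h⟩; omega
    have := Nat.findGreatest_spec (P := fun h => ¬ bl π Finset.univ v h) (Nat.zero_le n) h0
    apply this
    obtain ⟨p, hp, q, hq, h1, h2, h3, h4⟩ := H
    exact ⟨p, hp, q, hq, h1, h2, h3, by omega⟩
  · have := Nat.findGreatest_is_greatest H hn
    simpa using this

lemma exists_R (π : Equiv.Perm (Fin n)) : ∃ L : ℕ → ℕ, (∀ v, L v ≤ n) ∧
    ∀ v h, h ≤ n → (br π Finset.univ v h ↔ L v < h) := by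
  classical
  refine ⟨fun v => Nat.findGreatest (fun h => ¬ br π Finset.univ v h) n,
    fun v => Nat.findGreatest_le _, fun v h hn => ⟨fun H => ?_, fun H => ?_⟩⟩
  · by_contra hc
    dsimp only at hc
    have h0 : ¬ br π Finset.univ v 0 := by rintro ⟨p, -, q, -, -, -, -, h⟩; omega
    have := Nat.findGreatest_spec (P := fun h => ¬ br π Finset.univ v h) (Nat.zero_le n) h0
    apply this
    obtain ⟨p, hp, q, hq, h1, h2, h3, h4⟩ := H
    exact ⟨p, hp, q, hq, h1, h2, h3, by omega⟩
  · have := Nat.findGreatest_is_greatest H hn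
    simpa using this

lemma regime_const (hK : 2 ≤ K) (hFC : ∀ T ∈ FC, T.card ≤ K) (hFD : ∀ T ∈ FD, T.card ≤ K)
    {L R : ℕ → ℕ} (hLn : ∀ v, L v ≤ n)
    (hL : ∀ v h, h ≤ n → (bl π Finset.univ v h ↔ L v < h))
    (hR : ∀ v h, h ≤ n → (br π Finset.univ v h ↔ R v < h))
    (hall : ∀ v h, v ≤ n → h ≤ n → Obs π FC FD Finset.univ v h)
    (I : ℕ → Prop) (hI : ∀ v, I v → v ≤ n) (l : ℕ) (hl : ∀ v, I v → L v = l)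
    (hlR : ∀ v, I v → l ≤ R v) :
    Good π FC FD K 3 (fun v h => I v ∧ h ≤ n) := by
  classical
  by_cases hex : ∃ v, I v
  swap
  · exact good_false _ fun v h hv => hex ⟨v, hv.1⟩
  have hln : l ≤ n := by obtain ⟨v, hv⟩ := hex; rw [← hl v hv]; exact hLn v
  have g1 := good_tl (π := π) (FD := FD) hFC I hI l
  have g2 : Good π FC FD K 1 (fun v h => (I v ∧ tr π FD Finset.univ v l) ∧ h ≤ l) := by
    by_cases h2 : ∃ v, I v ∧ tr π FD Finset.univ v l
    · obtain ⟨b, ⟨-, hb⟩, hb'⟩ := exists_greatest (n := n) (fun v hv => hI v hv.1) h2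
      exact (good_tr_pt hFD hb).weaken fun v h hv => ⟨hb' v hv.1, hv.2⟩
    · exact good_false _ fun v h hv => h2 ⟨v, hv.1⟩
  have g3 : Good π FC FD K 1 (fun v h => I v ∧ l < h ∧ h ≤ n) := by
    by_cases h3 : l < n
    · have : bl π Finset.univ (Nat.find hex) (l + 1) := by
        rw [hL _ _ h3, hl _ (Nat.find_spec hex)]; omega
      exact (good_bl_pt hK this).weaken fun v h hv => ⟨Nat.find_min' hex hv.1, hv.2.1⟩
    · exact good_false _ fun v h hv => by omega
  refine ((g1.union g2).union g3).weaken ?_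
  rintro v h ⟨hv, hh⟩
  by_cases hlh : l < h
  · exact Or.inr ⟨hv, hlh, hh⟩
  left
  rcases hall v l (hI v hv) hln with H | H | H | H
  · exact Or.inl ⟨⟨hv, H⟩, by omega⟩
  · exact Or.inr ⟨⟨hv, H⟩, by omega⟩
  · rw [hL _ _ hln, hl v hv] at H; omega
  · rw [hR _ _ hln] at H; have := hlR v hv; omega

lemma regime_one (hK : 2 ≤ K) (hFC : ∀ T ∈ FC, T.card ≤ K) (hFD : ∀ T ∈ FD, T.card ≤ K)
    {L R : ℕ → ℕ} (hLn : ∀ v, L v ≤ n) (hRn : ∀ v, R v ≤ n)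
    (hL : ∀ v h, h ≤ n → (bl π Finset.univ v h ↔ L v < h))
    (hR : ∀ v h, h ≤ n → (br π Finset.univ v h ↔ R v < h))
    (hLm : Antitone L) (hRm : Monotone R)
    (hall : ∀ v h, v ≤ n → h ≤ n → Obs π FC FD Finset.univ v h)
    (w : ℕ) (hw : w ≤ n) (hRL : R w ≤ L w) :
    Good π FC FD K 4 (fun v h => v ≤ w ∧ h ≤ n) := by
  classical
  have key : ∀ v ≤ w, tl π FC Finset.univ v (R v) → tl π FC Finset.univ v (R w) := by
    rintro v hv ⟨T, hT, hTS, H⟩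
    refine ⟨T, hT, hTS, fun i hi => ⟨(H i hi).1, ?_⟩⟩
    obtain ⟨hi1, hi2⟩ := H i hi
    by_contra hc
    push Not at hc
    have hRwn := hRn w
    have h1 : br π Finset.univ v (R v + 1) := by rw [hR _ _ (by omega)]; omega
    obtain ⟨p, -, q, -, h1, h2, h3, h4⟩ := h1
    have hpw : (p : ℕ) < w := by
      by_contra hpw
      have : br π Finset.univ w (R w) :=
        ⟨p, Finset.mem_univ _, q, Finset.mem_univ _, h1, h2, by omega, by omega⟩
      rw [hR _ _ hRwn] at this; omega
    have hip : i < p := by rw [Fin.lt_def]; omega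
    have hne : π p ≠ π i := fun h => hip.ne' (π.injective h)
    have hlt : π p < π i := lt_of_le_of_ne (by rw [Fin.le_def]; omega) hne
    have : bl π Finset.univ w (L w) :=
      ⟨i, Finset.mem_univ _, p, Finset.mem_univ _, hip, hlt, hpw, by omega⟩
    rw [hL _ _ (hLn w)] at this; omega
  have g1 := good_tl (π := π) (FD := FD) hFC (· ≤ w) (fun v hv => hv.trans hw) (R w)
  have g2 : Good π FC FD K 1 (fun v h => v ≤ w ∧ R w < h ∧ h ≤ n) := by
    by_cases h3 : R w < n
    · have : br π Finset.univ w (R w + 1) := by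
        rw [hR _ _ h3]; omega
      exact (good_br_pt hK this).weaken fun v h hv => ⟨hv.1, hv.2.1⟩
    · exact good_false _ fun v h hv => by omega
  have g3 : Good π FC FD K (1 + 1)
      (fun v h => (v ≤ w ∧ tr π FD Finset.univ v (R v)) ∧ h ≤ n) := by
    by_cases h2 : ∃ v, v ≤ w ∧ tr π FD Finset.univ v (R v)
    · obtain ⟨b, ⟨hbw, hb⟩, hb'⟩ := exists_greatest (n := n) (fun v hv => hv.1.trans hw) h2
      have g4 : Good π FC FD K 1 (fun v h => v ≤ b ∧ R b < h ∧ h ≤ n) := by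
        by_cases h3 : R b < n
        · have : br π Finset.univ b (R b + 1) := by
            rw [hR _ _ h3]; omega
          exact (good_br_pt hK this).weaken fun v h hv => ⟨hv.1, hv.2.1⟩
        · exact good_false _ fun v h hv => by omega
      refine ((good_tr_pt hFD hb).union g4).weaken fun v h hv => ?_
      have := hb' v hv.1
      by_cases hh : h ≤ R b
      · exact Or.inl ⟨this, hh⟩
      · exact Or.inr ⟨this, by omega, hv.2⟩
    · exact good_false _ fun v h hv => h2 ⟨v, hv.1⟩
  refine ((g1.union g2).union g3).weaken ?_
  rintro v h ⟨hv, hh⟩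
  by_cases hlh : R w < h
  · exact Or.inl (Or.inr ⟨hv, hlh, hh⟩)
  rcases hall v (R v) (hv.trans hw) (hRn v) with H | H | H | H
  · exact Or.inl (Or.inl ⟨⟨hv, key v hv H⟩, by omega⟩)
  · exact Or.inr ⟨⟨hv, H⟩, hh⟩
  · rw [hL _ _ (hRn v)] at H
    have := hLm hv
    have := hRm hv
    omega
  · rw [hR _ _ (hRn v)] at H; omega

theorem core (hK : 2 ≤ K) (hFC : ∀ T ∈ FC, T.card ≤ K) (hFD : ∀ T ∈ FD, T.card ≤ K)
    (hall : ∀ v h, v ≤ n → h ≤ n → Obs π FC FD Finset.univ v h) :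
    ∃ S : Finset (Fin n), S.card ≤ 10 * K ∧ ∀ v h, v ≤ n → h ≤ n → Obs π FC FD S v h := by
  classical
  obtain ⟨L, hLn, hL⟩ := exists_L π
  obtain ⟨R, hRn, hR⟩ := exists_R π
  have hLm : Antitone L := by
    intro v w hvw
    by_contra hc
    push Not at hc
    have h1 : ¬ bl π Finset.univ w (L w) := by rw [hL _ _ (hLn w)]; omega
    have hwn := hLn w
    have h2 : bl π Finset.univ v (L w) := by rw [hL _ _ hwn]; omega
    obtain ⟨p, hp, q, hq, h3, h4, h5, h6⟩ := h2
    exact h1 ⟨p, hp, q, hq, h3, h4, by omega, h6⟩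
  have hRm : Monotone R := by
    intro v w hvw
    by_contra hc
    push Not at hc
    have hvn := hRn v
    have h1 : ¬ br π Finset.univ v (R v) := by rw [hR _ _ hvn]; omega
    have h2 : br π Finset.univ w (R v) := by rw [hR _ _ hvn]; omega
    obtain ⟨p, hp, q, hq, h3, h4, h5, h6⟩ := h2
    exact h1 ⟨p, hp, q, hq, h3, h4, by omega, h6⟩
  have h0 : R 0 ≤ L 0 := by
    have : ¬ bl π Finset.univ 0 n := by rintro ⟨p, -, q, -, -, -, h, -⟩; omega
    rw [hL _ _ le_rfl] at this
    have := hRn 0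
    omega
  obtain ⟨w, ⟨hwn, hw⟩, hw'⟩ := exists_greatest (n := n) (P := fun v => v ≤ n ∧ R v ≤ L v)
    (fun v hv => hv.1) ⟨0, Nat.zero_le _, h0⟩
  have hgt : ∀ v, w < v → v ≤ n → L v < R v := by
    intro v hv hvn
    by_contra hc
    have := hw' v ⟨hvn, by omega⟩
    omega
  have g1 := regime_one hK hFC hFD hLn hRn hL hR hLm hRm hall w hwn hw
  have g2 := regime_const hK hFC hFD hLn hL hR hall
    (fun v => (w + 1 ≤ v ∧ v ≤ n) ∧ L v = L (w + 1)) (fun v hv => hv.1.2) (L (w + 1))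
    (fun v hv => hv.2) (fun v hv => by have := hgt v hv.1.1 hv.1.2; have := hv.2; omega)
  have key : ∀ u v, w + 1 ≤ u → u ≤ v → v ≤ n → L u < L (w + 1) → L v = L u := by
    intro u v hu huv hvn hlt
    refine le_antisymm (hLm huv) ?_
    by_contra hc
    push Not at hc
    have hun := hLn u
    have hwn1 := hLn (w + 1)
    have hnbl : ¬ bl π Finset.univ u (L u) := by rw [hL _ _ hun]; omega
    have hnbr : ¬ br π Finset.univ (w + 1) (L (w + 1)) := by
      rw [hR _ _ hwn1]; have := hgt (w + 1) (by omega) (by omega); omega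
    have hnblw : ¬ bl π Finset.univ (w + 1) (L (w + 1)) := by rw [hL _ _ hwn1]; omega
    have e1 : bl π Finset.univ v (L v + 1) := by rw [hL _ _ (by omega)]; omega
    have e2 : bl π Finset.univ u (L u + 1) := by rw [hL _ _ (by omega)]; omega
    obtain ⟨p, -, q, -, a1, a2, a3, a4⟩ := e1
    obtain ⟨p', -, q', -, b1, b2, b3, b4⟩ := e2
    rw [Fin.lt_def] at a2 b2
    have hqu : u ≤ (q : ℕ) := by
      by_contra h
      exact hnbl ⟨p, Finset.mem_univ _, q, Finset.mem_univ _, a1, a2, by omega, by omega⟩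
    have hqw : w + 1 ≤ (q' : ℕ) := by
      by_contra h
      exact hnblw ⟨p', Finset.mem_univ _, q', Finset.mem_univ _, b1, b2, by omega, by omega⟩
    have hqq : q' < q := by rw [Fin.lt_def]; omega
    have hlt2 : π q' < π q := by
      by_contra h
      have hne : π q ≠ π q' := fun h => hqq.ne' (π.injective h)
      have : π q < π q' := lt_of_le_of_ne (not_lt.mp h) hne
      exact hnbr ⟨q', Finset.mem_univ _, q, Finset.mem_univ _, hqq, this, hqw, by omega⟩
    rw [Fin.lt_def] at hlt2
    rcases lt_trichotomy p q' with h | h | h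
    · exact hnbl ⟨p, Finset.mem_univ _, q', Finset.mem_univ _, h,
        by rw [Fin.lt_def]; omega, b3, by omega⟩
    · subst h; omega
    · rw [Fin.lt_def] at h
      exact hnbr ⟨p, Finset.mem_univ _, q, Finset.mem_univ _, a1, a2, by omega, by omega⟩
  have g3 : Good π FC FD K 3
      (fun v h => ((w + 1 ≤ v ∧ v ≤ n) ∧ L v < L (w + 1)) ∧ h ≤ n) := by
    by_cases hex : ∃ v, (w + 1 ≤ v ∧ v ≤ n) ∧ L v < L (w + 1)
    · obtain ⟨c, hc⟩ := hex
      refine regime_const hK hFC hFD hLn hL hR hall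
        (fun v => (w + 1 ≤ v ∧ v ≤ n) ∧ L v < L (w + 1)) (fun v hv => hv.1.2) (L c)
        (fun v hv => ?_) (fun v hv => ?_)
      · rcases le_total c v with h | h
        · exact key c v hc.1.1 h hv.1.2 hc.2
        · exact (key v c hv.1.1 h hc.1.2 hv.2).symm
      · have h1 := hgt v hv.1.1 hv.1.2
        have : L v = L c := by
          rcases le_total c v with h | h
          · exact key c v hc.1.1 h hv.1.2 hc.2
          · exact (key v c hv.1.1 h hc.1.2 hv.2).symm
        omega
    · exact good_false _ fun v h hv => hex ⟨v, hv.1⟩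
  obtain ⟨S, hS, H⟩ := (g1.union g2).union g3
  refine ⟨S, hS, fun v h hv hh => H v h ?_⟩
  by_cases h1 : v ≤ w
  · exact Or.inl (Or.inl ⟨h1, hh⟩)
  · have h2 : w + 1 ≤ v := by omega
    have := hLm h2
    rcases this.lt_or_eq with h3 | h3
    · exact Or.inr ⟨⟨⟨h2, hv⟩, h3⟩, hh⟩
    · exact Or.inl (Or.inr ⟨⟨⟨h2, hv⟩, h3⟩, hh⟩)

end core

/-- `f` embeds `σ` in `π`. -/
def Emb (σ π : Perm') (f : Fin σ.1 → Fin π.1) : Prop :=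
  StrictMono f ∧ ∀ i j : Fin σ.1, σ.2 i < σ.2 j ↔ π.2 (f i) < π.2 (f j)

lemma Emb.comp {ρ σ π : Perm'} {f : Fin σ.1 → Fin π.1} {g : Fin ρ.1 → Fin σ.1}
    (hf : Emb σ π f) (hg : Emb ρ σ g) : Emb ρ π (f ∘ g) :=
  ⟨hf.1.comp hg.1, fun i j => (hg.2 i j).trans (hf.2 _ _)⟩

/-- Every set of positions has a pattern. -/
lemma exists_pattern (π : Perm') (S : Finset (Fin π.1)) :
    ∃ (σ : Perm') (f : Fin σ.1 → Fin π.1), σ.1 = S.card ∧ Emb σ π f ∧ Set.range f = ↑S := by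
  classical
  have hc : (S.map π.2.toEmbedding).card = S.card := Finset.card_map _
  let e := S.orderIsoOfFin rfl
  let g := (S.map π.2.toEmbedding).orderIsoOfFin hc
  let m : S ≃ (S.map π.2.toEmbedding : Finset (Fin π.1)) :=
    { toFun := fun x => ⟨π.2 x, Finset.mem_map_of_mem _ x.2⟩
      invFun := fun y => ⟨π.2.symm y, by
        obtain ⟨x, hx, hxy⟩ := Finset.mem_map.mp y.2
        rw [← hxy]; simpa using hx⟩
      left_inv := fun x => by simp
      right_inv := fun y => by simp }
  refine ⟨⟨S.card, (e.toEquiv.trans m).trans g.symm.toEquiv⟩, fun i => (e i : Fin π.1), rfl,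
    ⟨fun i j hij => e.strictMono hij, fun i j => ?_⟩, ?_⟩
  · show g.symm (m (e i)) < g.symm (m (e j)) ↔ _
    rw [g.symm.lt_iff_lt]
    rfl
  · ext x
    constructor
    · rintro ⟨i, rfl⟩; exact (e i).2
    · intro hx; exact ⟨e.symm ⟨x, hx⟩, by simp⟩

/-- factor an embedding through another one -/
lemma Emb.factor {ρ σ π : Perm'} {f : Fin σ.1 → Fin π.1} {g : Fin ρ.1 → Fin π.1}
    (hf : Emb σ π f) (hg : Emb ρ π g) (h : ∀ i, g i ∈ Set.range f) :
    ∃ k : Fin ρ.1 → Fin σ.1, Emb ρ σ k ∧ ∀ i, f (k i) = g i := by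
  choose k hk using h
  refine ⟨k, ⟨fun i j hij => ?_, fun i j => ?_⟩, hk⟩
  · rw [← hf.1.lt_iff_lt, hk, hk]; exact hg.1 hij
  · rw [hg.2, hf.2, hk, hk]

lemma patternIn_iff (π : Perm') (S : Set (Fin π.1)) (B : Set Perm') :
    PatternIn π S (Av B) ↔ ∀ β ∈ B, ∀ f, Emb β π f → ¬ ∀ i, f i ∈ S := by
  classical
  constructor
  · rintro ⟨σ, hσ, g, hg1, hg2, hg3⟩ β hβ f hf hS
    obtain ⟨k, hk, -⟩ := Emb.factor (f := g) ⟨hg1, hg3⟩ hf (fun i => hg2 ▸ hS i)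
    exact hσ β hβ ⟨k, hk.1, hk.2⟩
  · intro H
    obtain ⟨σ, f, -, hf, hr⟩ := exists_pattern π S.toFinite.toFinset
    rw [Set.Finite.coe_toFinset] at hr
    refine ⟨σ, ?_, f, hf.1, hr, hf.2⟩
    rintro β hβ ⟨g, hg⟩
    exact H β hβ (f ∘ g) (hf.comp hg) fun i => hr ▸ ⟨g i, rfl⟩

/-- Copies of elements of `B` in `π`. -/
def Copies (B : Set Perm') (π : Perm') : Set (Finset (Fin π.1)) :=
  {T | ∃ β ∈ B, ∃ f, Emb β π f ∧ T = Finset.univ.image f}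

lemma emb21 (π : Perm') (p q : Fin π.1) (h : p < q) (h' : π.2 q < π.2 p) :
    Emb perm21 π (fun i : Fin 2 => if i = 0 then p else q) := by
  refine ⟨?_, ?_⟩
  · intro i j hij
    change Fin 2 at i j
    fin_cases i <;> fin_cases j <;> simp_all [perm21]
  · intro i j
    change Fin 2 at i j
    show (Equiv.swap (0 : Fin 2) 1) i < (Equiv.swap (0 : Fin 2) 1) j ↔ _
    have e0 : (Equiv.swap (0 : Fin 2) 1) 0 = 1 := by decide
    have e1 : (Equiv.swap (0 : Fin 2) 1) 1 = 0 := by decide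
    obtain rfl | rfl : i = 0 ∨ i = 1 := by omega
    all_goals obtain rfl | rfl : j = 0 ∨ j = 1 := by omega
    all_goals simp [e0, e1, h', h'.le]

lemma mem_grid_iff (BC BD : Set Perm') (π : Perm') :
    π ∈ GridClass (Av BC) (Av BD) (Av {perm21}) (Av {perm21}) ↔
      ∃ v h : ℕ, v ≤ π.1 ∧ h ≤ π.1 ∧
        ¬ Obs π.2 (Copies BC π) (Copies BD π) Finset.univ v h := by
  classical
  have h21 : ∀ S : Set (Fin π.1), PatternIn π S (Av {perm21}) ↔
      ∀ p ∈ S, ∀ q ∈ S, p < q → ¬ π.2 q < π.2 p := by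
    intro S
    rw [patternIn_iff]
    constructor
    · intro H p hp q hq hpq hlt
      refine H perm21 rfl _ (emb21 π p q hpq hlt) ?_
      intro i
      change Fin 2 at i
      show (if i = 0 then p else q) ∈ S
      split_ifs
      exacts [hp, hq]
    · rintro H β rfl f hf hS
      refine H _ (hS (0 : Fin 2)) _ (hS (1 : Fin 2)) (hf.1 (show (0 : Fin 2) < 1 by decide)) ?_
      refine (hf.2 (1 : Fin 2) (0 : Fin 2)).1 ?_
      show (Equiv.swap (0 : Fin 2) 1) 1 < (Equiv.swap (0 : Fin 2) 1) 0
      decide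
  have hB : ∀ (B : Set Perm') (S : Set (Fin π.1)), PatternIn π S (Av B) ↔
      ¬ ∃ T ∈ Copies B π, T ⊆ Finset.univ ∧ ∀ i ∈ T, i ∈ S := by
    intro B S
    rw [patternIn_iff]
    constructor
    · rintro H ⟨T, ⟨β, hβ, f, hf, rfl⟩, -, hT⟩
      exact H β hβ f hf fun i => hT _ (by simp)
    · intro H β hβ f hf hS
      exact H ⟨_, ⟨β, hβ, f, hf, rfl⟩, Finset.subset_univ _, by simpa using hS⟩
  refine exists_congr fun v => exists_congr fun h => and_congr_right fun _ =>
    and_congr_right fun _ => ?_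
  rw [h21, h21, hB, hB]
  unfold Obs
  rw [not_or, not_or, not_or]
  refine and_congr Iff.rfl (and_congr Iff.rfl (and_congr ?_ ?_))
  · constructor
    · rintro H ⟨p, -, q, -, h1, h2, h3, h4⟩
      rw [Fin.lt_def] at h1 h2
      exact H p ⟨by omega, h4⟩ q ⟨h3, by omega⟩ h1 h2
    · rintro H p hp q hq h1 h2
      exact H ⟨p, Finset.mem_univ _, q, Finset.mem_univ _, h1, h2, hq.1, hp.2⟩
  · constructor
    · rintro H ⟨p, -, q, -, h1, h2, h3, h4⟩
      rw [Fin.lt_def] at h1 h2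
      exact H p ⟨h3, h4⟩ q ⟨by omega, by omega⟩ h1 h2
    · rintro H p hp q hq h1 h2
      exact H ⟨p, Finset.mem_univ _, q, Finset.mem_univ _, h1, h2, hp.1, hp.2⟩

lemma exists_cut {n : ℕ} (P : Fin n → Prop) (hP : ∀ i j, i ≤ j → P j → P i) :
    ∃ v ≤ n, ∀ i : Fin n, P i ↔ (i : ℕ) < v := by
  classical
  have hex : ∃ v : ℕ, ∀ i : Fin n, P i → (i : ℕ) < v := ⟨n, fun i _ => i.2⟩
  refine ⟨Nat.find hex, Nat.find_min' hex (fun i _ => i.2), fun i => ⟨Nat.find_spec hex i, ?_⟩⟩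
  intro hi
  by_contra hc
  refine Nat.find_min hex hi fun j hj => ?_
  by_contra h
  exact hc (hP i j (by rw [Fin.le_def]; omega) hj)

lemma cut_down {k n : ℕ} (f : Fin k → Fin n) (hf : StrictMono f) (v : ℕ) :
    ∃ v' ≤ k, ∀ i, (f i : ℕ) < v ↔ (i : ℕ) < v' :=
  exists_cut (fun i => (f i : ℕ) < v) fun i j hij hj =>
    lt_of_le_of_lt (Fin.le_def.mp (hf.monotone hij)) hj

lemma cut_up {k n : ℕ} (f : Fin k → Fin n) (hf : StrictMono f) (v : ℕ) :
    ∃ v' ≤ n, ∀ i, (f i : ℕ) < v' ↔ (i : ℕ) < v := by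
  obtain ⟨v', hv', H⟩ := exists_cut (n := n) (fun j => ∃ i : Fin k, (i : ℕ) < v ∧ j ≤ f i)
    (fun i j hij ⟨a, ha, hb⟩ => ⟨a, ha, hij.trans hb⟩)
  refine ⟨v', hv', fun i => ?_⟩
  rw [← H]
  constructor
  · rintro ⟨a, ha, hb⟩
    have := hf.le_iff_le.mp hb
    rw [Fin.le_def] at this
    omega
  · intro hi; exact ⟨i, hi, le_rfl⟩

lemma Emb.value {σ π : Perm'} {f : Fin σ.1 → Fin π.1} (hf : Emb σ π f) :
    StrictMono (fun a => π.2 (f (σ.2.symm a))) := by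
  intro a b hab
  show π.2 (f (σ.2.symm a)) < π.2 (f (σ.2.symm b))
  rw [← hf.2]; simpa using hab

/-- Obstructions in the sub-pattern correspond to obstructions in the image. -/
lemma obs_iff {BC BD : Set Perm'} {σ π : Perm'} {f : Fin σ.1 → Fin π.1} (hf : Emb σ π f)
    {v h v' h' : ℕ} (hv : ∀ i, (f i : ℕ) < v ↔ (i : ℕ) < v')
    (hh : ∀ i, (π.2 (f i) : ℕ) < h ↔ (σ.2 i : ℕ) < h') (S : Finset (Fin π.1))
    (hS : (S : Set (Fin π.1)) = Set.range f) :
    Obs σ.2 (Copies BC σ) (Copies BD σ) Finset.univ v' h' ↔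
    Obs π.2 (Copies BC π) (Copies BD π) S v h := by
  classical
  have memS : ∀ i, f i ∈ S := fun i => by
    rw [← Finset.mem_coe, hS]; exact ⟨i, rfl⟩
  have hv2 : ∀ i, v ≤ (f i : ℕ) ↔ v' ≤ (i : ℕ) := fun i => by
    have := hv i; omega
  have hh2 : ∀ i, h ≤ (π.2 (f i) : ℕ) ↔ h' ≤ (σ.2 i : ℕ) := fun i => by
    have := hh i; omega
  have cop : ∀ (B : Set Perm') (P : Fin π.1 → Prop) (P' : Fin σ.1 → Prop),
      (∀ i, P (f i) ↔ P' i) →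
      ((∃ T ∈ Copies B σ, T ⊆ Finset.univ ∧ ∀ i ∈ T, P' i) ↔
        ∃ T ∈ Copies B π, T ⊆ S ∧ ∀ i ∈ T, P i) := by
    intro B P P' hPP
    constructor
    · rintro ⟨T, ⟨β, hβ, g, hg, rfl⟩, -, H⟩
      refine ⟨_, ⟨β, hβ, f ∘ g, hf.comp hg, rfl⟩, ?_, ?_⟩
      · intro x hx
        simp only [Finset.mem_image, Finset.mem_univ, true_and] at hx
        obtain ⟨a, rfl⟩ := hx
        exact memS _
      · intro x hx
        simp only [Finset.mem_image, Finset.mem_univ, true_and] at hx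
        obtain ⟨a, rfl⟩ := hx
        exact (hPP _).2 (H _ (by simp))
    · rintro ⟨T, ⟨β, hβ, g, hg, rfl⟩, hTS, H⟩
      obtain ⟨k, hk, hk2⟩ := Emb.factor hf hg (fun i => by
        rw [← hS]; exact hTS (by simp))
      refine ⟨_, ⟨β, hβ, k, hk, rfl⟩, Finset.subset_univ _, ?_⟩
      intro x hx
      simp only [Finset.mem_image, Finset.mem_univ, true_and] at hx
      obtain ⟨a, rfl⟩ := hx
      rw [← hPP, hk2]
      exact H _ (by simp)
  have ex : ∀ p ∈ S, ∃ i, f i = p := fun p hp => by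
    rw [← Finset.mem_coe, hS] at hp; exact hp
  refine or_congr ?_ (or_congr ?_ (or_congr ?_ ?_))
  · exact cop BC _ _ fun i => and_congr (hv i) (hh2 i)
  · exact cop BD _ _ fun i => and_congr (hv2 i) (hh2 i)
  · constructor
    · rintro ⟨p, -, q, -, h1, h2, h3, h4⟩
      exact ⟨f p, memS p, f q, memS q, hf.1 h1, (hf.2 _ _).1 h2, (hv _).2 h3, (hh _).2 h4⟩
    · rintro ⟨p, hp, q, hq, h1, h2, h3, h4⟩
      obtain ⟨p, rfl⟩ := ex p hp
      obtain ⟨q, rfl⟩ := ex q hq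
      exact ⟨p, Finset.mem_univ _, q, Finset.mem_univ _, hf.1.lt_iff_lt.1 h1, (hf.2 _ _).2 h2,
        (hv _).1 h3, (hh _).1 h4⟩
  · constructor
    · rintro ⟨p, -, q, -, h1, h2, h3, h4⟩
      exact ⟨f p, memS p, f q, memS q, hf.1 h1, (hf.2 _ _).1 h2, (hv2 _).2 h3, (hh _).2 h4⟩
    · rintro ⟨p, hp, q, hq, h1, h2, h3, h4⟩
      obtain ⟨p, rfl⟩ := ex p hp
      obtain ⟨q, rfl⟩ := ex q hq
      exact ⟨p, Finset.mem_univ _, q, Finset.mem_univ _, hf.1.lt_iff_lt.1 h1, (hf.2 _ _).2 h2,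
        (hv2 _).1 h3, (hh _).1 h4⟩

lemma grid_down (BC BD : Set Perm') (σ π : Perm')
    (hπ : π ∈ GridClass (Av BC) (Av BD) (Av {perm21}) (Av {perm21})) (hc : Contains σ π) :
    σ ∈ GridClass (Av BC) (Av BD) (Av {perm21}) (Av {perm21}) := by
  classical
  rw [mem_grid_iff] at hπ ⊢
  obtain ⟨v, h, -, -, H⟩ := hπ
  obtain ⟨f, hf⟩ := hc
  have hf : Emb σ π f := hf
  obtain ⟨v', hv', hv⟩ := cut_down f hf.1 v
  obtain ⟨h', hh', hh⟩ := cut_down _ hf.value h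
  refine ⟨v', h', hv', hh', fun hobs => H ?_⟩
  rw [obs_iff hf hv (fun i => by simpa using hh (σ.2 i)) (Finset.univ.image f) (by simp)] at hobs
  exact hobs.mono _ _ _ (Finset.subset_univ _)

lemma copies_card {B : Set Perm'} {K : ℕ} (hB : ∀ β ∈ B, β.1 ≤ K) (π : Perm') :
    ∀ T ∈ Copies B π, T.card ≤ K := by
  classical
  rintro T ⟨β, hβ, f, hf, rfl⟩
  exact (Finset.card_image_le.trans (by simp)).trans (hB β hβ)

lemma grid_up (BC BD : Set Perm') (K : ℕ) (hK : 2 ≤ K) (hBC : ∀ β ∈ BC, β.1 ≤ K)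
    (hBD : ∀ β ∈ BD, β.1 ≤ K) (π : Perm')
    (hπ : π ∉ GridClass (Av BC) (Av BD) (Av {perm21}) (Av {perm21})) :
    ∃ σ : Perm', σ.1 ≤ 10 * K ∧ Contains σ π ∧
      σ ∉ GridClass (Av BC) (Av BD) (Av {perm21}) (Av {perm21}) := by
  classical
  rw [mem_grid_iff] at hπ
  push Not at hπ
  obtain ⟨S, hS, H⟩ := core hK (copies_card hBC π) (copies_card hBD π) hπ
  obtain ⟨σ, f, hσ, hf, hr⟩ := exists_pattern π S
  refine ⟨σ, hσ ▸ hS, ⟨f, hf⟩, ?_⟩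
  rw [mem_grid_iff]
  rintro ⟨v', h', -, -, hn⟩
  obtain ⟨v, hvn, hv⟩ := cut_up f hf.1 v'
  obtain ⟨h, hhn, hh⟩ := cut_up _ hf.value h'
  apply hn
  rw [obs_iff hf hv (fun i => by simpa using hh (σ.2 i)) S hr.symm]
  exact H v h hvn hhn

lemma finite_le (N : ℕ) : {σ : Perm' | σ.1 ≤ N}.Finite := by
  have : {σ : Perm' | σ.1 ≤ N} ⊆
      Set.range (fun x : (Σ k : Fin (N + 1), Equiv.Perm (Fin k)) => (⟨x.1, x.2⟩ : Perm')) := by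
    rintro ⟨n, s⟩ h
    exact ⟨⟨⟨n, Nat.lt_succ_of_le h⟩, s⟩, rfl⟩
  exact (Set.finite_range _).subset this

lemma exists_bound {B : Set Perm'} (hB : B.Finite) : ∃ K, ∀ β ∈ B, β.1 ≤ K := by
  obtain ⟨K, hK⟩ := (hB.image (fun β : Perm' => β.1)).bddAbove
  exact ⟨K, fun β hβ => hK ⟨β, hβ, rfl⟩⟩

end GridAux

/-- For finitely based permutation classes `C`, `D`, the grid class
`Grid(C,D;Av 21,Av 21)` is finitely based. -/
theorem grid2x2_incr_incr_finitelyBased (C D : Set Perm')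
    (hC : IsPermClass C) (hD : IsPermClass D)
    (hCfb : FinitelyBased C) (hDfb : FinitelyBased D) :
    FinitelyBased (GridClass C D (Av {perm21}) (Av {perm21})) := by
  obtain ⟨BC, hBC, rfl⟩ := hCfb
  obtain ⟨BD, hBD, rfl⟩ := hDfb
  obtain ⟨K1, hK1⟩ := GridAux.exists_bound hBC
  obtain ⟨K2, hK2⟩ := GridAux.exists_bound hBD
  refine ⟨{σ | σ.1 ≤ 10 * (K1 + K2 + 2) ∧
    σ ∉ GridClass (Av BC) (Av BD) (Av {perm21}) (Av {perm21})},
    (GridAux.finite_le (10 * (K1 + K2 + 2))).subset fun σ h => h.1, ?_⟩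
  ext π
  constructor
  · rintro hπ β ⟨-, hβ⟩ hc
    exact hβ (GridAux.grid_down BC BD β π hπ hc)
  · intro H
    by_contra hπ
    obtain ⟨σ, h1, h2, h3⟩ := GridAux.grid_up BC BD (K1 + K2 + 2) (by omega)
      (fun β hβ => (hK1 β hβ).trans (by omega)) (fun β hβ => (hK2 β hβ).trans (by omega)) π hπ
    exact H σ ⟨h1, h3⟩ h2
end
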